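/- Let π be a probability distribution on a finite set A, let r, A: A → ℝ with E_π[A] = 0, fix γ > 0, and let π'(a) ∝ π(a)·exp(γ(A(a) + r(a))). Then E_{a∼π'}[A(a)] ≥ E_{a∼π}[r(a)] − E_{a∼π'}[r(a)]. -/

import Mathlib

/-- Chebyshev's association inequality: a real function and a monotone function of it are
nonnegatively correlated under any finite probability distribution. -/
theorem sum_mul_sum_comp_le_of_monotone {ι : Type*} [Fintype ι]
    {p : ι → ℝ} (hp0 : ∀ i, 0 ≤ p i) (hp1 : ∑ i, p i = 1)
    (f : ι → ℝ) {g : ℝ → ℝ} (hg : Monotone g) :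
    (∑ i, p i * f i) * ∑ i, p i * g (f i) ≤ ∑ i, p i * g (f i) * f i := by
  set m := ∑ i, p i * f i with hm
  have hnonneg : 0 ≤ ∑ i, p i * ((f i - m) * (g (f i) - g m)) := by
    refine Finset.sum_nonneg fun i _ => mul_nonneg (hp0 i) ?_
    rcases le_total m (f i) with h | h
    · exact mul_nonneg (sub_nonneg.2 h) (sub_nonneg.2 (hg h))
    · exact mul_nonneg_of_nonpos_of_nonpos (sub_nonpos.2 h) (sub_nonpos.2 (hg h))
  have hexpand : ∑ i, p i * ((f i - m) * (g (f i) - g m)) =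
      ∑ i, p i * g (f i) * f i - m * ∑ i, p i * g (f i)
        - g m * ∑ i, p i * f i + g m * m * ∑ i, p i := by
    simp only [Finset.mul_sum, ← Finset.sum_sub_distrib, ← Finset.sum_add_distrib]
    exact Finset.sum_congr rfl fun i _ => by ring
  rw [hexpand, ← hm, hp1] at hnonneg
  linarith

/-- The partition function of an exponentially tilted probability distribution is positive. -/
theorem sum_mul_exp_pos {ι : Type*} [Fintype ι]
    {p : ι → ℝ} (hp0 : ∀ i, 0 ≤ p i) (hp1 : ∑ i, p i = 1) (f : ι → ℝ) :
    0 < ∑ i, p i * Real.exp (f i) := by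
  obtain ⟨i, -, hi⟩ : ∃ i ∈ Finset.univ, 0 < p i :=
    Finset.exists_lt_of_sum_lt (by simp [hp1])
  exact Finset.sum_pos' (fun j _ => mul_nonneg (hp0 j) (Real.exp_pos _).le)
    ⟨i, Finset.mem_univ i, mul_pos hi (Real.exp_pos _)⟩

/-- Key inner-product lower bound: if `E_π[A] = 0` and
`π'(a) ∝ π(a)·exp(γ(A(a)+r(a)))`, then `E_{π'}[A] ≥ E_π[r] − E_{π'}[r]`. -/
theorem tilted_advantage_lower_bound
    {A : Type*} [Fintype A]
    (π : A → ℝ) (hπ0 : ∀ a, 0 ≤ π a) (hπ1 : ∑ a, π a = 1)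
    (r Adv : A → ℝ) (hA : ∑ a, π a * Adv a = 0)
    (γ : ℝ) (hγ : 0 < γ)
    (π' : A → ℝ)
    (hπ' : ∀ a, π' a = π a * Real.exp (γ * (Adv a + r a)) /
      (∑ b, π b * Real.exp (γ * (Adv b + r b)))) :
    ∑ a, π' a * Adv a ≥ (∑ a, π a * r a) - ∑ a, π' a * r a := by
  have hZ := sum_mul_exp_pos hπ0 hπ1 fun a => γ * (Adv a + r a)
  have hmono : Monotone fun x : ℝ => Real.exp (γ * x) := fun x y hxy =>
    Real.exp_le_exp.2 (mul_le_mul_of_nonneg_left hxy hγ.le)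
  have hcheb := sum_mul_sum_comp_le_of_monotone hπ0 hπ1 (fun a => Adv a + r a) hmono
  have htilt : ∑ a, π a * (Adv a + r a) ≤ ∑ a, π' a * (Adv a + r a) := by
    simp only [hπ', div_mul_eq_mul_div, ← Finset.sum_div]
    exact (le_div_iff₀ hZ).2 hcheb
  simp only [mul_add, Finset.sum_add_distrib, hA] at htilt
  linarith
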